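/- Let u, v, z : ℝ × ℝ → ℝ be smooth functions satisfying u_t = v - u u_x, v_t = z - u v_x, z_t = -u z_x, and suppose 2 u_x z_x - v_x² is nowhere vanishing. Then the function r = (u_x³/3 - u_x v_x + (3/2) z_x) / (2 u_x z_x - v_x²) satisfies the functional-differential equation D_t r + u_x r = 1 at every point, where D_t = ∂_t + u ∂_x. -/

import Mathlib

/-- Partial derivative in the first (space) variable. -/
noncomputable def pdx (f : ℝ → ℝ → ℝ) : ℝ → ℝ → ℝ := fun x t => deriv (fun y => f y t) x

/-- Partial derivative in the second (time) variable. -/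
noncomputable def pdt (f : ℝ → ℝ → ℝ) : ℝ → ℝ → ℝ := fun x t => deriv (fun s => f x s) t

/-- Smoothness of a function of two real variables. -/
def Smooth2 (f : ℝ → ℝ → ℝ) : Prop := ContDiff ℝ (⊤ : ℕ∞) (fun p : ℝ × ℝ => f p.1 p.2)

theorem Smooth2.hasDerivAt_fst {f : ℝ → ℝ → ℝ} (hf : Smooth2 f) (x t : ℝ) :
    HasDerivAt (fun y => f y t) (fderiv ℝ (fun p : ℝ × ℝ => f p.1 p.2) (x, t) (1, 0)) x :=
  HasFDerivAt.comp_hasDerivAt (l := fun p : ℝ × ℝ => f p.1 p.2) (f := fun y : ℝ => (y, t)) x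
    (ContDiff.differentiable hf (by simp) (x, t)).hasFDerivAt
    ((hasDerivAt_id x).prodMk (hasDerivAt_const x t))

theorem Smooth2.hasDerivAt_snd {f : ℝ → ℝ → ℝ} (hf : Smooth2 f) (x t : ℝ) :
    HasDerivAt (fun s => f x s) (fderiv ℝ (fun p : ℝ × ℝ => f p.1 p.2) (x, t) (0, 1)) t :=
  HasFDerivAt.comp_hasDerivAt (l := fun p : ℝ × ℝ => f p.1 p.2) (f := fun s : ℝ => (x, s)) t
    (ContDiff.differentiable hf (by simp) (x, t)).hasFDerivAt
    ((hasDerivAt_const t x).prodMk (hasDerivAt_id t))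

theorem Smooth2.pdx_eq {f : ℝ → ℝ → ℝ} (hf : Smooth2 f) (x t : ℝ) :
    pdx f x t = fderiv ℝ (fun p : ℝ × ℝ => f p.1 p.2) (x, t) (1, 0) :=
  (hf.hasDerivAt_fst x t).deriv

theorem Smooth2.pdt_eq {f : ℝ → ℝ → ℝ} (hf : Smooth2 f) (x t : ℝ) :
    pdt f x t = fderiv ℝ (fun p : ℝ × ℝ => f p.1 p.2) (x, t) (0, 1) :=
  (hf.hasDerivAt_snd x t).deriv

theorem Smooth2.hasDerivAt_pdx {f : ℝ → ℝ → ℝ} (hf : Smooth2 f) (x t : ℝ) :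
    HasDerivAt (fun y => f y t) (pdx f x t) x :=
  (hf.hasDerivAt_fst x t).differentiableAt.hasDerivAt

theorem Smooth2.hasDerivAt_pdt {f : ℝ → ℝ → ℝ} (hf : Smooth2 f) (x t : ℝ) :
    HasDerivAt (fun s => f x s) (pdt f x t) t :=
  (hf.hasDerivAt_snd x t).differentiableAt.hasDerivAt

theorem Smooth2.contDiff_fderiv {f : ℝ → ℝ → ℝ} (hf : Smooth2 f) :
    ContDiff ℝ (⊤ : ℕ∞) (fderiv ℝ (fun p : ℝ × ℝ => f p.1 p.2)) :=
  ContDiff.fderiv_right hf (by simp)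

theorem Smooth2.pdx {f : ℝ → ℝ → ℝ} (hf : Smooth2 f) : Smooth2 (pdx f) := by
  simp only [Smooth2, hf.pdx_eq]
  exact hf.contDiff_fderiv.clm_apply contDiff_const

theorem Smooth2.pdt {f : ℝ → ℝ → ℝ} (hf : Smooth2 f) : Smooth2 (pdt f) := by
  simp only [Smooth2, hf.pdt_eq]
  exact hf.contDiff_fderiv.clm_apply contDiff_const

/-- Mixed partial derivatives of a smooth function commute. -/
theorem Smooth2.pdt_pdx_comm {f : ℝ → ℝ → ℝ} (hf : Smooth2 f) (x t : ℝ) :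
    _root_.pdt (_root_.pdx f) x t = _root_.pdx (_root_.pdt f) x t := by
  have hd : DifferentiableAt ℝ (fderiv ℝ (fun p : ℝ × ℝ => f p.1 p.2)) (x, t) :=
    hf.contDiff_fderiv.differentiable (by simp) (x, t)
  have hsymm : IsSymmSndFDerivAt ℝ (fun p : ℝ × ℝ => f p.1 p.2) (x, t) :=
    (ContDiff.contDiffAt hf).isSymmSndFDerivAt
      (by
        rw [minSmoothness_of_isRCLikeNormedField]
        exact WithTop.coe_le_coe.2 (le_top : (2 : ℕ∞) ≤ ⊤))
  rw [hf.pdx.pdt_eq, hf.pdt.pdx_eq]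
  simp only [hf.pdx_eq, hf.pdt_eq, Prod.mk.eta]
  rw [fderiv_clm_apply hd (differentiableAt_const _),
    fderiv_clm_apply hd (differentiableAt_const _)]
  simpa using hsymm.eq (0, 1) (1, 0)

/-- The evolution of `f_x` along the flow of `u` when `f_t = g - u f_x`. -/
theorem Smooth2.pdt_pdx_of_pdt_eq {u f g : ℝ → ℝ → ℝ} (hu : Smooth2 u) (hf : Smooth2 f)
    (hg : Smooth2 g) (h : ∀ x t, _root_.pdt f x t = g x t - u x t * _root_.pdx f x t)
    (x t : ℝ) :
    _root_.pdt (_root_.pdx f) x t = _root_.pdx g x t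
      - (_root_.pdx u x t * _root_.pdx f x t + u x t * _root_.pdx (_root_.pdx f) x t) := by
  rw [hf.pdt_pdx_comm, show _root_.pdt f = fun x t => g x t - u x t * _root_.pdx f x t from
    funext fun x => funext fun t => h x t]
  exact ((hg.hasDerivAt_pdx x t).sub
    ((hu.hasDerivAt_pdx x t).mul (hf.pdx.hasDerivAt_pdx x t))).deriv

theorem hasDerivAt_quotient {a b c : ℝ → ℝ} {a' b' c' s : ℝ} (ha : HasDerivAt a a' s)
    (hb : HasDerivAt b b' s) (hc : HasDerivAt c c' s) (hne : 2 * a s * c s - b s ^ 2 ≠ 0) :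
    HasDerivAt (fun s => (a s ^ 3 / 3 - a s * b s + (3/2) * c s) / (2 * a s * c s - b s ^ 2))
      (((a s ^ 2 * a' - (a' * b s + a s * b') + (3/2) * c') * (2 * a s * c s - b s ^ 2)
        - (a s ^ 3 / 3 - a s * b s + (3/2) * c s)
          * (2 * a' * c s + 2 * a s * c' - 2 * b s * b')) / (2 * a s * c s - b s ^ 2) ^ 2) s := by
  refine (((((ha.fun_pow 3).div_const 3).fun_sub (ha.fun_mul hb)).fun_add
    (hc.const_mul (3/2))).fun_div (((ha.const_mul 2).fun_mul hc).fun_sub (hb.fun_pow 2))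
      hne).congr_deriv ?_
  push_cast
  ring

/-- the rational expression
`r = (u_x³/3 - u_x v_x + (3/2) z_x) / (2 u_x z_x - v_x²)` solves the
functional-differential equation `D_t r + u_x r = 1` along solutions of the
`N = 3` Riemann type system. -/
theorem statement15 (u v z : ℝ → ℝ → ℝ)
    (hu : Smooth2 u) (hv : Smooth2 v) (hz : Smooth2 z)
    (sys1 : ∀ x t, pdt u x t = v x t - u x t * pdx u x t)
    (sys2 : ∀ x t, pdt v x t = z x t - u x t * pdx v x t)
    (sys3 : ∀ x t, pdt z x t = -(u x t) * pdx z x t)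
    (hne : ∀ x t, 2 * pdx u x t * pdx z x t - (pdx v x t) ^ 2 ≠ 0) :
    ∀ x t,
      pdt (fun x t => ((pdx u x t) ^ 3 / 3 - pdx u x t * pdx v x t + (3/2) * pdx z x t)
          / (2 * pdx u x t * pdx z x t - (pdx v x t) ^ 2)) x t
      + u x t * pdx (fun x t => ((pdx u x t) ^ 3 / 3 - pdx u x t * pdx v x t
            + (3/2) * pdx z x t)
          / (2 * pdx u x t * pdx z x t - (pdx v x t) ^ 2)) x t
      + pdx u x t * (((pdx u x t) ^ 3 / 3 - pdx u x t * pdx v x t + (3/2) * pdx z x t)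
          / (2 * pdx u x t * pdx z x t - (pdx v x t) ^ 2)) = 1 := by
  intro x t
  have ha := hu.pdt_pdx_of_pdt_eq hu hv sys1 x t
  have hb := hu.pdt_pdx_of_pdt_eq hv hz sys2 x t
  have hc := hu.pdt_pdx_of_pdt_eq hz (g := fun _ _ => 0) contDiff_const
    (fun x t => by rw [sys3]; ring) x t
  have hzero : pdx (fun _ _ => (0 : ℝ)) x t = 0 := deriv_const x 0
  rw [hzero] at hc
  have hM := hne x t
  have ht := (hasDerivAt_quotient (hu.pdx.hasDerivAt_pdt x t) (hv.pdx.hasDerivAt_pdt x t)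
    (hz.pdx.hasDerivAt_pdt x t) hM).deriv
  have hx := (hasDerivAt_quotient (hu.pdx.hasDerivAt_pdx x t) (hv.pdx.hasDerivAt_pdx x t)
    (hz.pdx.hasDerivAt_pdx x t) hM).deriv
  change deriv _ t + u x t * deriv _ x + _ = 1
  rw [ht, hx, ha, hb, hc]
  generalize hMdef : 2 * pdx u x t * pdx z x t - pdx v x t ^ 2 = M at hM ⊢
  field_simp
  rw [← hMdef]
  ring
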